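/- arXiv:2410.14615 — 2 statements merged into one kernel-verified Lean document; each statement's English description precedes it below -/
import Mathlib

section
/- Assume ∫ (p̃0 + p̃1)(1 + |U′|) dμ < ∞. Then the thermodynamic integration identity holds: log Z1 − log Z0 = ∫_0^1 E_{X∼P_β}[ U′(X) ] dβ. Consequently, if β is drawn uniformly from [0,1] and, given β, X is drawn from P_β, then U′(X) is an unbiased estimator of log Z1 − log Z0: E_{β∼U([0,1])} E_{X∼P_β}[U′(X)] = log(Z1/Z0). -/
open MeasureTheory

/-- The geometric interpolation between two positive reals is at most their sum. -/
lemma rpow_mul_rpow_one_sub_le_add {a b β : ℝ} (ha : 0 < a) (hb : 0 < b)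
    (hβ : β ∈ Set.Icc (0 : ℝ) 1) : b ^ β * a ^ (1 - β) ≤ a + b := by
  have h := Real.geom_mean_le_arith_mean2_weighted hβ.1 (sub_nonneg.2 hβ.2) hb.le ha.le
    (by ring)
  nlinarith [mul_nonneg hβ.1 ha.le, mul_nonneg (sub_nonneg.2 hβ.2) hb.le]

lemma hasDerivAt_rpow_mul_rpow_one_sub {a b : ℝ} (ha : 0 < a) (hb : 0 < b) (β : ℝ) :
    HasDerivAt (fun t : ℝ => b ^ t * a ^ (1 - t))
      (b ^ β * a ^ (1 - β) * Real.log (b / a)) β := by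
  have h₁ := (hasDerivAt_id β).const_rpow hb
  have h₂ := ((hasDerivAt_id β).const_sub 1).const_rpow ha
  refine (h₁.mul h₂).congr_deriv ?_
  rw [Real.log_div hb.ne' ha.ne']
  simp only [id]
  ring

lemma norm_rpow_mul_rpow_one_sub_mul_le {a b β : ℝ} (ha : 0 < a) (hb : 0 < b)
    (hβ : β ∈ Set.Icc (0 : ℝ) 1) (c : ℝ) : ‖b ^ β * a ^ (1 - β) * c‖ ≤ (a + b) * |c| := by
  rw [norm_mul, Real.norm_eq_abs c, Real.norm_of_nonneg (by positivity)]
  exact mul_le_mul_of_nonneg_right (rpow_mul_rpow_one_sub_le_add ha hb hβ) (abs_nonneg c)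

section GeometricPath

variable {𝒳 : Type*} [MeasurableSpace 𝒳] {μ : Measure 𝒳} {p₀ p₁ g : 𝒳 → ℝ}

lemma integrable_rpow_mul_rpow_one_sub_mul (hp₀ : Measurable p₀) (hp₁ : Measurable p₁)
    (hp₀pos : ∀ x, 0 < p₀ x) (hp₁pos : ∀ x, 0 < p₁ x) (hg : Measurable g)
    (hint : Integrable (fun x => (p₀ x + p₁ x) * |g x|) μ) {β : ℝ}
    (hβ : β ∈ Set.Icc (0 : ℝ) 1) :
    Integrable (fun x => p₁ x ^ β * p₀ x ^ (1 - β) * g x) μ :=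
  hint.mono' (((hp₁.pow_const β).mul (hp₀.pow_const (1 - β))).mul hg).aestronglyMeasurable
    (ae_of_all _ fun x => norm_rpow_mul_rpow_one_sub_mul_le (hp₀pos x) (hp₁pos x) hβ (g x))

lemma continuousOn_integral_rpow_mul_rpow_one_sub_mul (hp₀ : Measurable p₀)
    (hp₁ : Measurable p₁) (hp₀pos : ∀ x, 0 < p₀ x) (hp₁pos : ∀ x, 0 < p₁ x)
    (hg : Measurable g) (hint : Integrable (fun x => (p₀ x + p₁ x) * |g x|) μ) :
    ContinuousOn (fun β : ℝ => ∫ x, p₁ x ^ β * p₀ x ^ (1 - β) * g x ∂μ) (Set.Icc 0 1) := by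
  refine continuousOn_of_dominated (bound := fun x => (p₀ x + p₁ x) * |g x|)
    (fun β hβ => ?_) (fun β hβ => ae_of_all _ fun x => ?_) hint (ae_of_all _ fun x => ?_)
  · exact (integrable_rpow_mul_rpow_one_sub_mul hp₀ hp₁ hp₀pos hp₁pos hg hint
      hβ).aestronglyMeasurable
  · exact norm_rpow_mul_rpow_one_sub_mul_le (hp₀pos x) (hp₁pos x) hβ (g x)
  · exact fun β _ => ((hasDerivAt_rpow_mul_rpow_one_sub (hp₀pos x) (hp₁pos x)
      β).continuousAt.mul continuousAt_const).continuousWithinAt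

lemma hasDerivAt_integral_rpow_mul_rpow_one_sub (hp₀ : Measurable p₀) (hp₁ : Measurable p₁)
    (hp₀pos : ∀ x, 0 < p₀ x) (hp₁pos : ∀ x, 0 < p₁ x)
    (hsum : Integrable (fun x => p₀ x + p₁ x) μ)
    (hlog : Integrable (fun x => (p₀ x + p₁ x) * |Real.log (p₁ x / p₀ x)|) μ) {β : ℝ}
    (hβ : β ∈ Set.Ioo (0 : ℝ) 1) :
    HasDerivAt (fun t : ℝ => ∫ x, p₁ x ^ t * p₀ x ^ (1 - t) ∂μ)
      (∫ x, p₁ x ^ β * p₀ x ^ (1 - β) * Real.log (p₁ x / p₀ x) ∂μ) β := by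
  have hβ' := Set.Ioo_subset_Icc_self hβ
  refine (hasDerivAt_integral_of_dominated_loc_of_deriv_le
    (F' := fun t x => p₁ x ^ t * p₀ x ^ (1 - t) * Real.log (p₁ x / p₀ x))
    (isOpen_Ioo.mem_nhds hβ) (.of_forall fun t => ?_) ?_ ?_
    (ae_of_all _ fun x t ht => norm_rpow_mul_rpow_one_sub_mul_le (hp₀pos x) (hp₁pos x)
      (Set.Ioo_subset_Icc_self ht) _) hlog
    (ae_of_all _ fun x t _ =>
      hasDerivAt_rpow_mul_rpow_one_sub (hp₀pos x) (hp₁pos x) t)).2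
  · exact ((hp₁.pow_const t).mul (hp₀.pow_const (1 - t))).aestronglyMeasurable
  · simpa using integrable_rpow_mul_rpow_one_sub_mul hp₀ hp₁ hp₀pos hp₁pos
      (g := fun _ => 1) measurable_const (by simpa using hsum) hβ'
  · exact (integrable_rpow_mul_rpow_one_sub_mul hp₀ hp₁ hp₀pos hp₁pos
      (hp₁.div hp₀).log hlog hβ').aestronglyMeasurable

end GeometricPath

/-- **Thermodynamic integration identity and unbiasedness.**
With `p̃β = p̃₁^β p̃₀^{1-β}`, `Z_β = ∫ p̃β dμ`, `P_β` the probability measure with density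
`p̃β / Z_β`, and `U′ = log (p̃₁/p̃₀)`, if `∫ (p̃₀ + p̃₁)(1 + |U′|) dμ < ∞` then
`log Z₁ - log Z₀ = ∫₀¹ E_{X ∼ P_β}[U′(X)] dβ`; equivalently, for `β ∼ Uniform([0,1])`
and `X | β ∼ P_β`, the statistic `U′(X)` is an unbiased estimator of `log (Z₁/Z₀)`. -/
theorem thermodynamic_integration_identity
    {𝒳 : Type*} [MeasurableSpace 𝒳] (μ : Measure 𝒳) [SigmaFinite μ]
    (p₀ p₁ : 𝒳 → ℝ) (hp₀ : Measurable p₀) (hp₁ : Measurable p₁)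
    (hp₀pos : ∀ x, 0 < p₀ x) (hp₁pos : ∀ x, 0 < p₁ x)
    (hint₀ : Integrable p₀ μ) (hint₁ : Integrable p₁ μ)
    (hZ₀pos : 0 < ∫ x, p₀ x ∂μ) (hZ₁pos : 0 < ∫ x, p₁ x ∂μ)
    (hdom : Integrable (fun x => (p₀ x + p₁ x) * (1 + |Real.log (p₁ x / p₀ x)|)) μ) :
    (Real.log (∫ x, p₁ x ∂μ) - Real.log (∫ x, p₀ x ∂μ)
      = ∫ β in (0 : ℝ)..1,
          (∫ x, (p₁ x ^ β * p₀ x ^ (1 - β) / (∫ y, p₁ y ^ β * p₀ y ^ (1 - β) ∂μ)) *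
              Real.log (p₁ x / p₀ x) ∂μ)) ∧
    -- unbiasedness: the mean over `β ∼ Uniform([0,1])` of `E_{X ∼ P_β}[U′(X)]`
    (∫ β in Set.Icc (0 : ℝ) 1,
        (∫ x, (p₁ x ^ β * p₀ x ^ (1 - β) / (∫ y, p₁ y ^ β * p₀ y ^ (1 - β) ∂μ)) *
            Real.log (p₁ x / p₀ x) ∂μ)
      = Real.log ((∫ x, p₁ x ∂μ) / (∫ x, p₀ x ∂μ))) := by
  have hsum : Integrable (fun x => p₀ x + p₁ x) μ := hint₀.add hint₁
  have hlog : Integrable (fun x => (p₀ x + p₁ x) * |Real.log (p₁ x / p₀ x)|) μ := by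
    refine (hdom.sub hsum).congr (ae_of_all _ fun x => ?_)
    simp only [Pi.sub_apply]
    ring
  have hμ : 0 < μ Set.univ := by
    refine pos_iff_ne_zero.2 fun h => hZ₀pos.ne' ?_
    simp [Measure.measure_univ_eq_zero.1 h]
  have hsum' : Integrable (fun x => (p₀ x + p₁ x) * |(1 : ℝ)|) μ := by simpa using hsum
  have hZpos : ∀ β ∈ Set.Icc (0 : ℝ) 1, 0 < ∫ x, p₁ x ^ β * p₀ x ^ (1 - β) ∂μ := by
    intro β hβ
    have hpos : ∀ x, 0 < p₁ x ^ β * p₀ x ^ (1 - β) := fun x =>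
      mul_pos (Real.rpow_pos_of_pos (hp₁pos x) _) (Real.rpow_pos_of_pos (hp₀pos x) _)
    have hint : Integrable (fun x => p₁ x ^ β * p₀ x ^ (1 - β)) μ := by
      simpa using integrable_rpow_mul_rpow_one_sub_mul hp₀ hp₁ hp₀pos hp₁pos
        (g := fun _ => 1) measurable_const hsum' hβ
    rwa [integral_pos_iff_support_of_nonneg (fun x => (hpos x).le) hint,
      Function.support_eq_univ fun x => (hpos x).ne']
  have hZcont : ContinuousOn (fun β : ℝ => ∫ x, p₁ x ^ β * p₀ x ^ (1 - β) ∂μ)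
      (Set.Icc 0 1) := by
    simpa using continuousOn_integral_rpow_mul_rpow_one_sub_mul hp₀ hp₁ hp₀pos hp₁pos
      (g := fun _ => 1) measurable_const hsum'
  have hDcont := continuousOn_integral_rpow_mul_rpow_one_sub_mul hp₀ hp₁ hp₀pos hp₁pos
    (hp₁.div hp₀).log hlog
  have key := intervalIntegral.integral_eq_sub_of_hasDerivAt_of_le zero_le_one
    (hZcont.log fun β hβ => (hZpos β hβ).ne')
    (fun β hβ => (hasDerivAt_integral_rpow_mul_rpow_one_sub hp₀ hp₁ hp₀pos hp₁pos hsum hlog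
      hβ).log (hZpos β (Set.Ioo_subset_Icc_self hβ)).ne')
    ((hDcont.div hZcont fun β hβ => (hZpos β hβ).ne').intervalIntegrable_of_Icc zero_le_one)
  have hmean : ∀ β : ℝ,
      (∫ x, (p₁ x ^ β * p₀ x ^ (1 - β) / (∫ y, p₁ y ^ β * p₀ y ^ (1 - β) ∂μ)) *
          Real.log (p₁ x / p₀ x) ∂μ) =
        (∫ x, p₁ x ^ β * p₀ x ^ (1 - β) * Real.log (p₁ x / p₀ x) ∂μ) /
          ∫ y, p₁ y ^ β * p₀ y ^ (1 - β) ∂μ := fun β => by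
    rw [← integral_div]
    simp only [div_mul_eq_mul_div]
  simp only [hmean]
  rw [integral_Icc_eq_integral_Ioc, ← intervalIntegral.integral_of_le zero_le_one,
    Real.log_div hZ₁pos.ne' hZ₀pos.ne', key]
  simp
end

section
/- Let X have density p0 = p̃0/Z0 with respect to μ, let Y be a real random variable independent of X with mean c = log(Z0/Z1) and variance σ² > 0, and let D = D_KL(P1‖P0) ∈ (0,∞). For t ∈ ℝ let M(t) = E[exp(t (Y − c))], and for (γ, β) with β > 0 define F(γ, β) = E[ (p1(X)/p0(X))^γ ] · M(γβ)^{1/β}, with F(γ, 0) = E[(p1(X)/p0(X))^γ], so that F(1,0) = 1. Fix ε > 0 and suppose there exist δ̄ > 0 and β̄ > 0 such that F is finite and continuously differentiable on [1−δ̄, 1] × [0, β̄] with partial derivatives ∂F/∂γ (1,0) = D and ∂F/∂β (1,0) = σ²/2. Then there exists i₀ such that for every integer i ≥ i₀, setting γ₀ = 1 − (σ² + 2ε)/(2 i D), one has F(γ₀, 1/i) ≤ 1; equivalently, if T_i is the average of i i.i.d. copies of Y (independent of X), then E[ exp( γ₀ log(p1(X)/p0(X)) + γ₀ (T_i − c)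 ) ] ≤ 1. -/
open MeasureTheory ProbabilityTheory

/-- If `f` has a negative derivative at `0` within `[0, r]`, then `f ≤ f 0` just to the right
of `0`. -/
theorem eventually_le_of_hasDerivWithinAt_neg {f : ℝ → ℝ} {f' r : ℝ} (hr : 0 < r)
    (hf : HasDerivWithinAt f f' (Set.Icc 0 r) 0) (hf' : f' < 0) :
    ∀ᶠ s in nhdsWithin 0 (Set.Ioi 0), f s ≤ f 0 := by
  have h : HasDerivWithinAt f f' (Set.Ioi 0) 0 :=
    (hf.mono Set.Ioc_subset_Icc_self).mono_of_mem_nhdsWithin (Ioc_mem_nhdsGT hr)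
  rw [hasDerivWithinAt_iff_tendsto_slope' (by simp)] at h
  filter_upwards [h.eventually_lt_const hf', self_mem_nhdsWithin] with s hs hpos
  rw [slope_def_field, sub_zero, div_lt_iff₀ hpos] at hs
  linarith

/-- The derivative of a function of two variables along the segment `s ↦ (1 - a s, s)` at the
corner `(1, 0)` of a rectangle, in terms of its one-sided partial derivatives. -/
theorem hasDerivWithinAt_corner {G : ℝ × ℝ → ℝ} {δ β a A B r : ℝ} (hδ : 0 < δ) (hβ : 0 < β)
    (ha : 0 ≤ a) (hrβ : r ≤ β) (hrδ : a * r ≤ δ)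
    (hG : DifferentiableWithinAt ℝ G (Set.Icc (1 - δ) 1 ×ˢ Set.Icc 0 β) (1, 0))
    (hA : HasDerivWithinAt (fun x => G (x, 0)) A (Set.Icc (1 - δ) 1) 1)
    (hB : HasDerivWithinAt (fun y => G (1, y)) B (Set.Icc 0 β) 0) :
    HasDerivWithinAt (fun s => G (1 - a * s, s)) (-a * A + B) (Set.Icc 0 r) 0 := by
  obtain ⟨L, hL⟩ := hG
  have hLA : L (1, 0) = A := by
    refine UniqueDiffWithinAt.eq_deriv _ (uniqueDiffOn_Icc (by linarith) 1 (by simp [hδ.le])) ?_ hA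
    refine HasFDerivWithinAt.comp_hasDerivWithinAt (1 : ℝ) hL (f := fun x : ℝ => (x, (0 : ℝ))) ?_ ?_
    · exact (hasDerivWithinAt_id _ _).prodMk (hasDerivWithinAt_const _ _ _)
    · intro x hx
      exact ⟨hx, by simp [hβ.le]⟩
  have hLB : L (0, 1) = B := by
    refine UniqueDiffWithinAt.eq_deriv _ (uniqueDiffOn_Icc hβ 0 (by simp [hβ.le])) ?_ hB
    refine HasFDerivWithinAt.comp_hasDerivWithinAt (0 : ℝ) hL (f := fun y : ℝ => ((1 : ℝ), y)) ?_ ?_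
    · exact (hasDerivWithinAt_const _ _ _).prodMk (hasDerivWithinAt_id _ _)
    · intro y hy
      exact ⟨by simp [hδ.le], hy⟩
  have hL' : L (-a, 1) = -a * A + B := by
    rw [← hLA, ← hLB, ← smul_eq_mul, ← map_smul, ← map_add]
    simp
  rw [← hL']
  refine HasFDerivWithinAt.comp_hasDerivWithinAt_of_eq (0 : ℝ) hL
    (f := fun s : ℝ => (1 - a * s, s)) ?_ ?_ (by simp)
  · have h : HasDerivWithinAt (fun s : ℝ => 1 - a * s) (-a) (Set.Icc 0 r) 0 := by
      simpa using ((hasDerivWithinAt_id (0 : ℝ) (Set.Icc 0 r)).const_mul a).const_sub 1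
    exact h.prodMk (hasDerivWithinAt_id _ _)
  · rintro s ⟨hs0, hsr⟩
    have h1 := mul_nonneg ha hs0
    have h2 := mul_le_mul_of_nonneg_left hsr ha
    exact ⟨⟨by simp only; linarith, by simp only; linarith⟩, hs0, hsr.trans hrβ⟩

/-- The likelihood ratio `g / f` has mean `∫ g ∂μ` under the law with positive `μ`-density `f`. -/
theorem integral_div_comp_of_map_eq_withDensity {𝒳 Ω : Type*} [MeasurableSpace 𝒳]
    [MeasurableSpace Ω] {μ : Measure 𝒳} {P : Measure Ω} {X : Ω → 𝒳} {f g : 𝒳 → ℝ}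
    (hX : Measurable X) (hf : Measurable f) (hg : Measurable g) (hpos : ∀ x, 0 < f x)
    (hlaw : Measure.map X P = μ.withDensity (fun x => ENNReal.ofReal (f x))) :
    ∫ ω, g (X ω) / f (X ω) ∂P = ∫ x, g x ∂μ := by
  rw [← integral_map (f := fun x => g x / f x) hX.aemeasurable
    (hg.div hf).aestronglyMeasurable, hlaw,
    integral_withDensity_eq_integral_toReal_smul hf.ennreal_ofReal (by simp)]
  refine integral_congr_ae (Filter.Eventually.of_forall fun x => ?_)
  have := hpos x
  simp only [ENNReal.toReal_ofReal this.le, smul_eq_mul]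
  field_simp

/-- **Choice of `γ₀` for asymptotic optimality of LPA-CUSUM.** Let `X ∼ p₀ = p̃₀/Z₀`,
let `Y` be independent of `X` with mean `c = log (Z₀/Z₁)` and variance `σ² > 0`, and let
`D = D_KL(P₁‖P₀) ∈ (0,∞)`.  With `M t = E[exp (t (Y - c))]` and
`F γ β = E[(p₁(X)/p₀(X))^γ] ⬝ M (γβ)^{1/β}` for `β > 0`, `F γ 0 = E[(p₁(X)/p₀(X))^γ]`,
suppose `F` is finite and continuously differentiable on `[1-δ̄, 1] × [0, β̄]` with
`∂F/∂γ (1,0) = D` and `∂F/∂β (1,0) = σ²/2`.  Then for every `ε > 0` there is `i₀` such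
that for all `i ≥ i₀`, with `γ₀ = 1 - (σ² + 2ε)/(2 i D)`, one has `F (γ₀, 1/i) ≤ 1`. -/
theorem exists_sample_size_F_le_one
    {𝒳 : Type*} [MeasurableSpace 𝒳] (μ : Measure 𝒳) [SigmaFinite μ]
    (p₀ p₁ : 𝒳 → ℝ) (hp₀ : Measurable p₀) (hp₁ : Measurable p₁)
    (hp₀pos : ∀ x, 0 < p₀ x) (hp₁pos : ∀ x, 0 < p₁ x)
    (hint₀ : Integrable p₀ μ) (hint₁ : Integrable p₁ μ)
    (Z₀ Z₁ : ℝ) (hZ₀ : Z₀ = ∫ x, p₀ x ∂μ) (hZ₁ : Z₁ = ∫ x, p₁ x ∂μ)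
    (hZ₀pos : 0 < Z₀) (hZ₁pos : 0 < Z₁)
    {Ω : Type*} [MeasurableSpace Ω] (P : Measure Ω) [IsProbabilityMeasure P]
    (X : Ω → 𝒳) (Y : Ω → ℝ) (hXmeas : Measurable X) (hYmeas : Measurable Y)
    -- `X` has the pre-change density `p₀ = p̃₀ / Z₀` with respect to `μ`
    (hXlaw : Measure.map X P = μ.withDensity (fun x => ENNReal.ofReal (p₀ x / Z₀)))
    (hindep : IndepFun X Y P)
    -- `Y` has mean `c = log (Z₀/Z₁)` and variance `σ² > 0`
    (c : ℝ) (hc : c = Real.log (Z₀ / Z₁))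
    (hYint : Integrable Y P) (hYmean : (∫ ω, Y ω ∂P) = c)
    (σ2 : ℝ) (hσ2 : variance Y P = σ2) (hσ2pos : 0 < σ2)
    -- the Kullback–Leibler divergence `D = D_KL(P₁‖P₀) ∈ (0, ∞)`
    (D : ℝ) (hD : D = ∫ x, (p₁ x / Z₁) * Real.log ((p₁ x / Z₁) / (p₀ x / Z₀)) ∂μ)
    (hDint : Integrable (fun x => (p₁ x / Z₁) * Real.log ((p₁ x / Z₁) / (p₀ x / Z₀))) μ)
    (hDpos : 0 < D)
    -- the moment generating function `M` of `Y - c` and the function `F`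
    (M : ℝ → ℝ) (hM : ∀ t, M t = ∫ ω, Real.exp (t * (Y ω - c)) ∂P)
    (F : ℝ → ℝ → ℝ)
    (hF : ∀ γ β : ℝ, F γ β =
      if β = 0 then ∫ ω, ((p₁ (X ω) / Z₁) / (p₀ (X ω) / Z₀)) ^ γ ∂P
      else (∫ ω, ((p₁ (X ω) / Z₁) / (p₀ (X ω) / Z₀)) ^ γ ∂P) * M (γ * β) ^ (1 / β))
    (ε : ℝ) (hε : 0 < ε)
    (δbar βbar : ℝ) (hδbar : 0 < δbar) (hβbar : 0 < βbar)
    -- finiteness of `F` on the rectangle `[1-δ̄, 1] × [0, β̄]`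
    (hFfin₁ : ∀ γ ∈ Set.Icc (1 - δbar) 1,
      Integrable (fun ω => ((p₁ (X ω) / Z₁) / (p₀ (X ω) / Z₀)) ^ γ) P)
    (hFfin₂ : ∀ t ∈ Set.Icc (0 : ℝ) βbar,
      Integrable (fun ω => Real.exp (t * (Y ω - c))) P)
    -- continuous differentiability of `F` on the rectangle, with the stated
    -- partial derivatives at `(1, 0)`
    (hFsmooth : ContDiffOn ℝ 1 (fun q : ℝ × ℝ => F q.1 q.2)
      (Set.Icc (1 - δbar) 1 ×ˢ Set.Icc 0 βbar))
    (hFγ : HasDerivWithinAt (fun γ => F γ 0) D (Set.Icc (1 - δbar) 1) 1)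
    (hFβ : HasDerivWithinAt (fun β => F 1 β) (σ2 / 2) (Set.Icc 0 βbar) 0) :
    ∃ i₀ : ℕ, ∀ i : ℕ, i₀ ≤ i →
      F (1 - (σ2 + 2 * ε) / (2 * i * D)) (1 / i) ≤ 1 := by
  have hF10 : F 1 0 = 1 := by
    rw [hF, if_pos rfl]
    simp only [Real.rpow_one]
    rw [integral_div_comp_of_map_eq_withDensity (f := fun x => p₀ x / Z₀)
      (g := fun x => p₁ x / Z₁) hXmeas (hp₀.div_const _) (hp₁.div_const _)
      (fun x => div_pos (hp₀pos x) hZ₀pos) hXlaw, integral_div, ← hZ₁, div_self hZ₁pos.ne']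
  set a := (σ2 + 2 * ε) / (2 * D) with ha_def
  have ha : 0 < a := by positivity
  have hr : 0 < min βbar (δbar / a) := by positivity
  have hder := hasDerivWithinAt_corner (r := min βbar (δbar / a)) hδbar hβbar ha.le
    (min_le_left _ _) ((mul_comm _ _).trans_le ((le_div_iff₀ ha).1 (min_le_right _ _)))
    (hFsmooth.differentiableOn one_ne_zero (1, 0) ⟨by simp [hδbar.le], by simp [hβbar.le]⟩) hFγ hFβ
  have hneg : -a * D + σ2 / 2 < 0 := by
    have : a * D = σ2 / 2 + ε := by
      rw [ha_def]
      field_simp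
    linarith
  have hev := tendsto_inv_atTop_nhdsGT_zero.eventually
    (eventually_le_of_hasDerivWithinAt_neg hr hder hneg)
  obtain ⟨i₀, hi₀⟩ := Filter.eventually_atTop.1 (tendsto_natCast_atTop_atTop.eventually hev)
  refine ⟨i₀, fun i hi => ?_⟩
  have h := hi₀ i hi
  simp only [mul_zero, sub_zero, hF10] at h
  have he : (σ2 + 2 * ε) / (2 * i * D) = a * (i : ℝ)⁻¹ := by
    rw [ha_def, mul_right_comm, ← div_div, div_eq_mul_inv _ (i : ℝ)]
  rwa [he, one_div]
end
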